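/- Let T be a text of length n over a finite totally ordered alphabet Σ, let π be an order-preserving permutation for T, and let P ∈ Σ^m (m ≥ 1) be a pattern that occurs in T. Then there is exactly one primary occurrence of P, i.e., exactly one position i with T[i, i+m−1] = P and LPF_π[i] < m; moreover, this position i satisfies π(i) < π(j) for every other position j ≠ i at which P occurs in T. -/

import Mathlib

/-!
Common definitions: strings are modeled as functions `S : ℕ → A` with 1-based
positions `1,…,n`; patterns/substrings as `List A`.
-/

open scoped Classical

/-- Length of the longest common prefix of the suffixes `S[i,n]` and `S[j,n]`
(1-based indexing): the largest `k` with `i+k-1 ≤ n`, `j+k-1 ≤ n` and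
`S[i,i+k-1] = S[j,j+k-1]`. -/
noncomputable def rlce {A : Type*} (S : ℕ → A) (n i j : ℕ) : ℕ :=
  Nat.findGreatest
    (fun k => i + k ≤ n + 1 ∧ j + k ≤ n + 1 ∧ ∀ t < k, S (i + t) = S (j + t)) n

/-- `π` is order-preserving for the string `S[1,n]`: whenever `π i < π j` and
`S[i,i+1] = S[j,j+1]` (for `i, j ∈ [n-1]`), also `π (i+1) < π (j+1)`. -/
def OrderPres {A : Type*} (S : ℕ → A) (n : ℕ) (π : ℕ → ℕ) : Prop :=
  ∀ i j, 1 ≤ i → i < n → 1 ≤ j → j < n → π i < π j →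
    S i = S j → S (i + 1) = S (j + 1) → π (i + 1) < π (j + 1)

/-- `π` is a permutation of `{1,…,n}`. -/
def PermOn (π : ℕ → ℕ) (n : ℕ) : Prop :=
  Set.BijOn π (Set.Icc 1 n) (Set.Icc 1 n)

/-- Generalized Longest Previous Factor array `LPF_π` of `S[1,n]`:
`LPF_π[i] = 0` if `π i = 1`, and `LPF_π[i] = max { rlce(j,i) : j ∈ [n], π j < π i }`
otherwise. -/
noncomputable def LPF {A : Type*} (S : ℕ → A) (n : ℕ) (π : ℕ → ℕ) (i : ℕ) : ℕ :=
  if π i = 1 then 0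
  else ((Finset.Icc 1 n).filter (fun j => π j < π i)).sup (fun j => rlce S n j i)

/-- `i` is an irreducible `LPF_π` position: `i = 1` or `LPF_π[i] ≠ LPF_π[i-1] - 1`
(the right-hand side taken over the integers). -/
def Irr {A : Type*} (S : ℕ → A) (n : ℕ) (π : ℕ → ℕ) (i : ℕ) : Prop :=
  i = 1 ∨ (LPF S n π i : ℤ) ≠ (LPF S n π (i - 1) : ℤ) - 1

/-- The Path Decomposition Array `PDA_π = { i + LPF_π[i] : i ∈ [n] }`, as a finite set. -/
noncomputable def PDA {A : Type*} (S : ℕ → A) (n : ℕ) (π : ℕ → ℕ) : Finset ℕ :=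
  (Finset.Icc 1 n).image (fun i => i + LPF S n π i)

/-- The string `w` occurs in `S` starting at (1-based) position `i`. -/
def occursAt {A : Type*} (S : ℕ → A) (w : List A) (i : ℕ) : Prop :=
  ∀ (t : ℕ) (ht : t < w.length), S (i + t) = w.get ⟨t, ht⟩

/-- `w` is a substring of `S[1,n]`. -/
def IsSubstr {A : Type*} (S : ℕ → A) (n : ℕ) (w : List A) : Prop :=
  ∃ i, 1 ≤ i ∧ i + w.length ≤ n + 1 ∧ occursAt S w i

/-- `w` is a suffix of the prefix `S[1,j]`. -/
def SuffixOfPrefix {A : Type*} (S : ℕ → A) (w : List A) (j : ℕ) : Prop :=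
  w.length ≤ j ∧ occursAt S w (j - w.length + 1)

/-- `w` is a right-maximal substring of `S[1,n]`: it is a substring of `S[1,n]` and
either a suffix of `S[1,n]`, or it has two distinct one-character right-extensions
occurring in `S[1,n]`. -/
def RightMaximal {A : Type*} (S : ℕ → A) (n : ℕ) (w : List A) : Prop :=
  IsSubstr S n w ∧
    (SuffixOfPrefix S w n ∨
      ∃ a b : A, a ≠ b ∧ IsSubstr S n (w ++ [a]) ∧ IsSubstr S n (w ++ [b]))

/-- `T[1,n]` is a text: `n ≥ 1` and the terminator `T n` is strictly smaller than
(in particular, different from) every other symbol of the text. -/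
def IsText {A : Type*} [LT A] (T : ℕ → A) (n : ℕ) : Prop :=
  1 ≤ n ∧ ∀ i, 1 ≤ i → i < n → T n < T i

/-- The suffix `S[i,n]` as a list. -/
def sufList {A : Type*} (S : ℕ → A) (n i : ℕ) : List A :=
  (List.range (n + 1 - i)).map (fun t => S (i + t))

/-- The prefix `S[1,i]` as a list. -/
def preList {A : Type*} (S : ℕ → A) (i : ℕ) : List A :=
  (List.range i).map (fun t => S (1 + t))

/-- `SA` is the suffix array of `T[1,n]`: a permutation of `[n]` listing the starting
positions of the suffixes of `T` in increasing lexicographic order. -/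
def IsSA {A : Type*} [LinearOrder A] (T : ℕ → A) (n : ℕ) (SA : ℕ → ℕ) : Prop :=
  PermOn SA n ∧ ∀ i j, 1 ≤ i → i < j → j ≤ n →
    List.Lex (· < ·) (sufList T n (SA i)) (sufList T n (SA j))

/-- `g` is the inverse of `f` on `{1,…,n}`. -/
def IsInv (f g : ℕ → ℕ) (n : ℕ) : Prop :=
  (∀ i, 1 ≤ i → i ≤ n → g (f i) = i) ∧ (∀ i, 1 ≤ i → i ≤ n → f (g i) = i)

/-- `PA` is the prefix array of `T[1,n]`: a permutation of `[n]` listing the ending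
positions of the prefixes of `T` in increasing colexicographic order. -/
def IsPA {A : Type*} [LinearOrder A] (T : ℕ → A) (n : ℕ) (PA : ℕ → ℕ) : Prop :=
  PermOn PA n ∧ ∀ i j, 1 ≤ i → i < j → j ≤ n →
    List.Lex (· < ·) (preList T (PA i)).reverse (preList T (PA j)).reverse

/-- The Burrows–Wheeler transform: `BWT[i] = T[SA[i] - 1]`, with the convention
`T[0] := T[n]`. -/
def BWT {A : Type*} (T : ℕ → A) (n : ℕ) (SA : ℕ → ℕ) (i : ℕ) : A :=
  T (if SA i = 1 then n else SA i - 1)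

/-- The co-Burrows–Wheeler transform: `coBWT[i] = T[PA[i] + 1]`, with the convention
`T[n+1] := T[1]`. -/
def coBWT {A : Type*} (T : ℕ → A) (n : ℕ) (PA : ℕ → ℕ) (i : ℕ) : A :=
  T (if PA i = n then 1 else PA i + 1)

/-- Number of maximal equal-symbol runs of `B[1,n]` (for `n ≥ 1`). -/
noncomputable def runs {A : Type*} (B : ℕ → A) (n : ℕ) : ℕ :=
  1 + ((Finset.Icc 2 n).filter (fun i => B i ≠ B (i - 1))).card

theorem exists_minimal_pi (π : ℕ → ℕ) {Q : ℕ → Prop} (h : ∃ i, Q i) :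
    ∃ i, Q i ∧ ∀ j, Q j → π i ≤ π j := by
  obtain ⟨i, hi⟩ := h
  exact ⟨Function.argminOn π {x | Q x} ⟨i, hi⟩,
    Function.argminOn_mem π {x | Q x} ⟨i, hi⟩,
    fun j hj => Function.argminOn_le π {x | Q x} hj⟩

theorem rlce_spec' {A : Type*} (T : ℕ → A) (n j i : ℕ) (h : rlce T n j i ≠ 0) :
    j + rlce T n j i ≤ n + 1 ∧ i + rlce T n j i ≤ n + 1 ∧
      ∀ t < rlce T n j i, T (j + t) = T (i + t) :=
  Nat.findGreatest_of_ne_zero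
    (P := fun k => j + k ≤ n + 1 ∧ i + k ≤ n + 1 ∧ ∀ t < k, T (j + t) = T (i + t))
    (n := n) rfl h

theorem le_rlce' {A : Type*} (T : ℕ → A) (n i j m : ℕ) (hn : m ≤ n) (h1 : i + m ≤ n + 1)
    (h2 : j + m ≤ n + 1) (h : ∀ t < m, T (i + t) = T (j + t)) : m ≤ rlce T n i j := by
  unfold rlce
  exact Nat.le_findGreatest hn ⟨h1, h2, h⟩

/-- A pattern `P` (of positive length) occurring in the text `T[1,n]`
has exactly one primary occurrence (one with `LPF_π[i] < |P|`), and this primary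
occurrence minimizes `π` among all occurrences of `P`. -/
theorem primary_occurrence_unique {A : Type*} [Fintype A] [LinearOrder A]
    (T : ℕ → A) (n : ℕ) (htext : IsText T n)
    (π : ℕ → ℕ) (hperm : PermOn π n) (hop : OrderPres T n π)
    (P : List A) (hm : 1 ≤ P.length)
    (hocc : ∃ i, 1 ≤ i ∧ i + P.length ≤ n + 1 ∧ occursAt T P i) :
    ∃ i, (1 ≤ i ∧ i + P.length ≤ n + 1 ∧ occursAt T P i ∧ LPF T n π i < P.length) ∧
      (∀ j, 1 ≤ j → j + P.length ≤ n + 1 → occursAt T P j → LPF T n π j < P.length →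
        j = i) ∧
      (∀ j, 1 ≤ j → j + P.length ≤ n + 1 → occursAt T P j → j ≠ i → π i < π j) := by
  obtain ⟨i, ⟨hi1, hi2, hi3⟩, hmin⟩ := exists_minimal_pi π hocc
  have hlt : ∀ j, 1 ≤ j → j + P.length ≤ n + 1 → occursAt T P j → j ≠ i → π i < π j := by
    intro j h1 h2 h3 hne
    refine lt_of_le_of_ne (hmin j ⟨h1, h2, h3⟩) ?_
    intro he
    exact hne (hperm.injOn ⟨h1, by omega⟩ ⟨hi1, by omega⟩ he.symm)
  refine ⟨i, ⟨hi1, hi2, hi3, ?_⟩, ?_, hlt⟩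
  · unfold LPF
    split_ifs with h
    · omega
    · rw [Finset.sup_lt_iff (by simp; omega)]
      intro j hj
      simp only [Finset.mem_filter, Finset.mem_Icc] at hj
      by_contra hge
      have hge : P.length ≤ rlce T n j i := not_lt.mp hge
      have hs : j + rlce T n j i ≤ n + 1 ∧ i + rlce T n j i ≤ n + 1 ∧
          ∀ t < rlce T n j i, T (j + t) = T (i + t) :=
        rlce_spec' T n j i (by omega)
      have := hmin j ⟨hj.1.1, by omega, fun t ht => by
        rw [hs.2.2 t (by omega)]; exact hi3 t ht⟩
      omega
  · intro j h1 h2 h3 h4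
    by_contra hne
    have hp := hlt j h1 h2 h3 hne
    have hpi : 1 ≤ π i := (hperm.mapsTo ⟨hi1, by omega⟩).1
    unfold LPF at h4
    rw [if_neg (by omega)] at h4
    have ha : P.length ≤ rlce T n i j := by
      exact le_rlce' T n i j _ (by omega) hi2 h2 (fun t ht => by rw [hi3 t ht, h3 t ht])
    have hb : rlce T n i j ≤
        ((Finset.Icc 1 n).filter (fun k => π k < π j)).sup (fun k => rlce T n k j) :=
      Finset.le_sup (f := fun k => rlce T n k j) (by simp; omega)
    omega
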